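/- Fix n ∈ ℕ and let M = ℝ × EuclideanSpace ℝ (Fin n) be Minkowski space with time function τ(p) = p.1 and null distance d̂. Then the null distance encodes causality: for all p, q ∈ M, q ≼ p (i.e. dist(q.2, p.2) ≤ p.1 − q.1) if and only if p.1 − q.1 = d̂(p, q). -/

import Mathlib

open Metric

/-- The causal relation on Minkowski space `ℝ × EuclideanSpace ℝ (Fin n)` with time
function the first coordinate: `q ≼ p` iff `dist q.2 p.2 ≤ p.1 - q.1`. -/
def MinkCausal {n : ℕ} (q p : ℝ × EuclideanSpace ℝ (Fin n)) : Prop :=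
  dist q.2 p.2 ≤ p.1 - q.1

/-- A null chain from `p` to `q`: a finite sequence `c 0 = p, …, c (2N) = q` alternating
past-directed and future-directed causal steps, i.e. `c (2i+1) ≼ c (2i)` and
`c (2i+1) ≼ c (2i+2)` for all `i < N`. -/
def IsNullChain {n : ℕ} (p q : ℝ × EuclideanSpace ℝ (Fin n)) (N : ℕ)
    (c : ℕ → ℝ × EuclideanSpace ℝ (Fin n)) : Prop :=
  c 0 = p ∧ c (2 * N) = q ∧
    ∀ i < N, MinkCausal (c (2 * i + 1)) (c (2 * i)) ∧
      MinkCausal (c (2 * i + 1)) (c (2 * i + 2))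

/-- The null length of a chain: the sum of the absolute time differences along the
chain. -/
noncomputable def nullLength {n : ℕ} (N : ℕ)
    (c : ℕ → ℝ × EuclideanSpace ℝ (Fin n)) : ℝ :=
  ∑ i ∈ Finset.range (2 * N), |(c (i + 1)).1 - (c i).1|

/-- The null distance on Minkowski space: the infimum of the null lengths of all null
chains from `p` to `q`. -/
noncomputable def nullDist {n : ℕ} (p q : ℝ × EuclideanSpace ℝ (Fin n)) : ℝ :=
  sInf {L | ∃ (N : ℕ) (c : ℕ → ℝ × EuclideanSpace ℝ (Fin n)),
    IsNullChain p q N c ∧ L = nullLength N c}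

/-- The restricted null distance on a subset `S` of Minkowski space: the infimum of the
null lengths of all null chains from `p` to `q` whose points all lie in `S`. -/
noncomputable def nullDistIn {n : ℕ} (S : Set (ℝ × EuclideanSpace ℝ (Fin n)))
    (p q : ℝ × EuclideanSpace ℝ (Fin n)) : ℝ :=
  sInf {L | ∃ (N : ℕ) (c : ℕ → ℝ × EuclideanSpace ℝ (Fin n)),
    IsNullChain p q N c ∧ (∀ i ≤ 2 * N, c i ∈ S) ∧ L = nullLength N c}

/-- Along each step of a null chain, the spatial distance is at most the time separation. -/
theorem IsNullChain.dist_le_abs {n : ℕ} {p q : ℝ × EuclideanSpace ℝ (Fin n)} {N : ℕ}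
    {c : ℕ → ℝ × EuclideanSpace ℝ (Fin n)} (h : IsNullChain p q N c) {i : ℕ}
    (hi : i < 2 * N) : dist (c i).2 (c (i + 1)).2 ≤ |(c (i + 1)).1 - (c i).1| := by
  obtain ⟨k, rfl | rfl⟩ := Nat.even_or_odd' i
  · have hk := (h.2.2 k (by omega)).1
    unfold MinkCausal at hk
    rw [dist_comm, abs_sub_comm]
    exact hk.trans (le_abs_self _)
  · exact (h.2.2 k (by omega)).2.trans (le_abs_self _)

theorem IsNullChain.dist_le_nullLength {n : ℕ} {p q : ℝ × EuclideanSpace ℝ (Fin n)} {N : ℕ}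
    {c : ℕ → ℝ × EuclideanSpace ℝ (Fin n)} (h : IsNullChain p q N c) :
    dist p.2 q.2 ≤ nullLength N c := by
  rw [← h.1, ← h.2.1]
  exact dist_le_range_sum_of_dist_le (f := fun i => (c i).2) (2 * N) h.dist_le_abs

theorem IsNullChain.abs_sub_le_nullLength {n : ℕ} {p q : ℝ × EuclideanSpace ℝ (Fin n)} {N : ℕ}
    {c : ℕ → ℝ × EuclideanSpace ℝ (Fin n)} (h : IsNullChain p q N c) :
    |p.1 - q.1| ≤ nullLength N c := by
  rw [← h.1, ← h.2.1, ← Real.dist_eq]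
  refine dist_le_range_sum_of_dist_le (f := fun i => (c i).1) (2 * N) fun {i} _ => ?_
  rw [Real.dist_eq, abs_sub_comm]

/-- A common causal predecessor `r` of `p` and `q` gives the null chain `p, r, q`. -/
theorem exists_isNullChain_of_minkCausal {n : ℕ} {p q r : ℝ × EuclideanSpace ℝ (Fin n)}
    (hp : MinkCausal r p) (hq : MinkCausal r q) :
    ∃ (N : ℕ) (c : ℕ → ℝ × EuclideanSpace ℝ (Fin n)),
      IsNullChain p q N c ∧ (p.1 - r.1) + (q.1 - r.1) = nullLength N c := by
  have hp' : 0 ≤ p.1 - r.1 := dist_nonneg.trans hp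
  have hq' : 0 ≤ q.1 - r.1 := dist_nonneg.trans hq
  refine ⟨1, fun i => if i = 0 then p else if i = 1 then r else q, ⟨rfl, rfl, ?_⟩, ?_⟩
  · intro i hi
    obtain rfl : i = 0 := by omega
    simpa using ⟨hp, hq⟩
  · simp [nullLength, Finset.sum_range_succ, abs_sub_comm r.1 p.1, abs_of_nonneg hp',
      abs_of_nonneg hq']

theorem exists_common_minkCausal {n : ℕ} (p q : ℝ × EuclideanSpace ℝ (Fin n)) :
    ∃ r, MinkCausal r p ∧ MinkCausal r q := by
  refine ⟨(min p.1 q.1 - dist p.2 q.2, p.2), ?_, ?_⟩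
  · have := min_le_left p.1 q.1
    have := dist_nonneg (x := p.2) (y := q.2)
    simp only [MinkCausal, dist_self]
    linarith
  · have := min_le_right p.1 q.1
    simp only [MinkCausal]
    linarith

theorem dist_le_nullDist {n : ℕ} (p q : ℝ × EuclideanSpace ℝ (Fin n)) :
    dist p.2 q.2 ≤ nullDist p q := by
  obtain ⟨r, hp, hq⟩ := exists_common_minkCausal p q
  obtain ⟨N, c, hc, hL⟩ := exists_isNullChain_of_minkCausal hp hq
  refine le_csInf ⟨_, N, c, hc, hL⟩ ?_
  rintro _ ⟨N, c, hc, rfl⟩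
  exact hc.dist_le_nullLength

theorem nullDist_eq_of_minkCausal {n : ℕ} {p q : ℝ × EuclideanSpace ℝ (Fin n)}
    (h : MinkCausal q p) : nullDist p q = p.1 - q.1 := by
  obtain ⟨N, c, hc, hL⟩ := exists_isNullChain_of_minkCausal h (r := q) (q := q) (by
    simp [MinkCausal])
  rw [sub_self, add_zero] at hL
  refine IsLeast.csInf_eq ⟨⟨N, c, hc, hL⟩, ?_⟩
  rintro _ ⟨N, c, hc, rfl⟩
  exact (le_abs_self _).trans hc.abs_sub_le_nullLength

/-- The null distance on Minkowski space encodes causality: `q ≼ p` iff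
`p.1 - q.1 = nullDist p q`. -/
theorem nullDist_encodes_causality (n : ℕ) (p q : ℝ × EuclideanSpace ℝ (Fin n)) :
    MinkCausal q p ↔ p.1 - q.1 = nullDist p q := by
  refine ⟨fun h => (nullDist_eq_of_minkCausal h).symm, fun h => ?_⟩
  rw [MinkCausal, h, dist_comm]
  exact dist_le_nullDist p q
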